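/- arXiv:1707.06664 — 2 statements merged into one kernel-verified Lean document; each statement's English description precedes it below -/
import Mathlib

section
/- There exists a universal constant C > 0 such that for every real Δ > 1 and all naturals D, n with 2 ≤ D ≤ n, there exist a natural m with m ≤ C·(1 + D·log₂(D)·log₂(n)/log₂(Δ)), a matrix M ∈ F₂^{m×n}, and a decoder g : F₂^m → ℝ such that for every x ∈ F₂^n with 1 ≤ ‖x‖₀ ≤ D, ‖x‖₀/Δ ≤ g(M⊙x) ≤ Δ·‖x‖₀. -/
/-- The sparsity (number of nonzero entries) of a vector over `F₂`. -/
def sparsity {n : ℕ} (x : Fin n → ZMod 2) : ℕ :=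
  (Finset.univ.filter (fun i => x i ≠ 0)).card

/-- The group testing output: `(M ⊙ x) i = 1` iff some coordinate `j` tested by row `i`
(`M i j = 1`) is defective (`x j = 1`). -/
def orMul {m n : ℕ} (M : Matrix (Fin m) (Fin n) (ZMod 2)) (x : Fin n → ZMod 2) :
    Fin m → ZMod 2 :=
  fun i => if ∃ j, M i j = 1 ∧ x j = 1 then 1 else 0

open Finset in
/-- One step of the method of conditional expectations: a random `i` separates each `c ∈ P` with
probability at least `q`, so some `i` leaves at most a fraction `1 - q` unseparated. -/
lemma exists_card_filter_not_le {ι κ : Type*} [Fintype ι] (w : ι → ℝ) (hw : ∀ i, 0 ≤ w i)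
    (hw1 : ∑ i, w i = 1) (sep : ι → κ → Prop) [∀ i c, Decidable (sep i c)] (P : Finset κ) (q : ℝ)
    (h : ∀ c ∈ P, q ≤ ∑ i, if sep i c then w i else 0) :
    ∃ i, ((P.filter fun c => ¬ sep i c).card : ℝ) ≤ (1 - q) * P.card := by
  by_contra! hcon
  have h1 : ∑ i, w i * ((P.filter fun c => ¬ sep i c).card : ℝ) ≤ (1 - q) * P.card := by
    have h2 : ∑ i, w i * ((P.filter fun c => ¬ sep i c).card : ℝ)
        = ∑ c ∈ P, (1 - ∑ i, if sep i c then w i else 0) := by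
      simp_rw [card_filter, Nat.cast_sum, mul_sum]
      rw [sum_comm]
      refine sum_congr rfl fun c _ => ?_
      rw [← hw1, ← sum_sub_distrib]
      refine sum_congr rfl fun i _ => ?_
      by_cases hs : sep i c <;> simp [hs]
    rw [h2, mul_comm, ← nsmul_eq_mul]
    exact sum_le_card_nsmul _ _ _ fun c hc => by linarith [h c hc]
  have h3 : ∑ i, w i * ((1 - q) * P.card) <
      ∑ i, w i * ((P.filter fun c => ¬ sep i c).card : ℝ) := by
    obtain ⟨i, hi⟩ : ∃ i, 0 < w i := by
      by_contra! hneg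
      have := sum_nonpos fun i (_ : i ∈ univ) => hneg i
      linarith
    exact sum_lt_sum (fun i _ => mul_le_mul_of_nonneg_left (hcon i).le (hw i))
      ⟨i, mem_univ i, mul_lt_mul_of_pos_left (hcon i) hi⟩
  rw [← sum_mul, hw1, one_mul] at h3
  linarith

open Finset in
lemma exists_fin_card_filter_le {ι κ : Type*} [Fintype ι] (w : ι → ℝ) (hw : ∀ i, 0 ≤ w i)
    (hw1 : ∑ i, w i = 1) (sep : ι → κ → Prop) [∀ i c, Decidable (sep i c)] (P : Finset κ) (q : ℝ)
    (hq : q ≤ 1) (h : ∀ c ∈ P, q ≤ ∑ i, if sep i c then w i else 0) (m : ℕ) :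
    ∃ t : Fin m → ι, ((P.filter fun c => ∀ k, ¬ sep (t k) c).card : ℝ) ≤ (1 - q) ^ m * P.card := by
  induction m with
  | zero => exact ⟨Fin.elim0, by simp⟩
  | succ m ih =>
    obtain ⟨t, ht⟩ := ih
    obtain ⟨i, hi⟩ := exists_card_filter_not_le w hw hw1 sep
      (P.filter fun c => ∀ k, ¬ sep (t k) c) q fun c hc => h c (mem_filter.1 hc).1
    refine ⟨Fin.cons i t, ?_⟩
    have he : (P.filter fun c => ∀ k, ¬ sep ((Fin.cons i t : Fin (m + 1) → ι) k) c) =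
        (P.filter fun c => ∀ k, ¬ sep (t k) c).filter fun c => ¬ sep i c := by
      ext c
      simp only [mem_filter, Fin.forall_fin_succ, Fin.cons_zero, Fin.cons_succ]
      tauto
    rw [he, pow_succ', mul_assoc]
    exact hi.trans (mul_le_mul_of_nonneg_left ht (by linarith))

lemma exists_fin_forall_separated {ι κ : Type*} [Fintype ι] (w : ι → ℝ) (hw : ∀ i, 0 ≤ w i)
    (hw1 : ∑ i, w i = 1) (sep : ι → κ → Prop) (P : Finset κ) (q : ℝ)
    (hq : q ≤ 1) [∀ i c, Decidable (sep i c)]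
    (h : ∀ c ∈ P, q ≤ ∑ i, if sep i c then w i else 0)
    (m : ℕ) (L : ℝ) (hP : (P.card : ℝ) ≤ Real.exp L) (hm : L < q * m) :
    ∃ t : Fin m → ι, ∀ c ∈ P, ∃ k, sep (t k) c := by
  obtain ⟨t, ht⟩ := exists_fin_card_filter_le w hw hw1 sep P q hq h m
  have h1 : (1 - q) ^ m ≤ Real.exp (-(q * m)) := by
    calc (1 - q) ^ m ≤ Real.exp (-q) ^ m :=
          pow_le_pow_left₀ (by linarith) (Real.one_sub_le_exp_neg q) m
      _ = Real.exp (-(q * m)) := by rw [← Real.exp_nat_mul]; ring_nf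
  have h2 : (1 - q) ^ m * P.card < 1 := by
    calc (1 - q) ^ m * P.card ≤ Real.exp (-(q * m)) * Real.exp L := by gcongr
      _ = Real.exp (L - q * m) := by rw [← Real.exp_add]; ring_nf
      _ < 1 := Real.exp_lt_one_iff.2 (by linarith)
  have h3 : (P.filter fun c => ∀ k, ¬ sep (t k) c).card = 0 := by
    have : ((P.filter fun c => ∀ k, ¬ sep (t k) c).card : ℝ) < 1 := ht.trans_lt h2
    exact_mod_cast Nat.lt_one_iff.1 (by exact_mod_cast this)
  refine ⟨t, fun c hc => ?_⟩
  by_contra! hcon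
  exact (Finset.card_ne_zero_of_mem (Finset.mem_filter.2 ⟨hc, hcon⟩)) h3

/-- The probability of `T` as a random subset of `Fin n` of density `p`. -/
noncomputable def binomialWeight {n : ℕ} (p : ℝ) (T : Finset (Fin n)) : ℝ :=
  p ^ T.card * (1 - p) ^ (n - T.card)

lemma sum_binomialWeight {n : ℕ} (p : ℝ) : ∑ T : Finset (Fin n), binomialWeight p T = 1 := by
  simp [binomialWeight, Fin.sum_pow_mul_eq_add_pow]

lemma binomialWeight_nonneg {n : ℕ} {p : ℝ} (h0 : 0 ≤ p) (h1 : p ≤ 1) (T : Finset (Fin n)) :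
    0 ≤ binomialWeight p T :=
  mul_nonneg (pow_nonneg h0 _) (pow_nonneg (by linarith) _)

open Finset in
lemma sum_binomialWeight_disjoint {n : ℕ} (p : ℝ) (S : Finset (Fin n)) :
    ∑ T : Finset (Fin n), (if Disjoint T S then binomialWeight p T else 0) = (1 - p) ^ S.card := by
  rw [← sum_filter]
  have he : (univ.filter fun T : Finset (Fin n) => Disjoint T S) = Sᶜ.powerset := by
    ext T
    simp [subset_compl_iff_disjoint_right]
  rw [he]
  have h1 := sum_pow_mul_eq_add_pow p (1 - p) Sᶜ
  rw [add_sub_cancel, one_pow] at h1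
  refine Eq.trans ?_ (mul_one _)
  refine Eq.trans ?_ (congrArg _ h1)
  rw [mul_sum]
  refine sum_congr rfl fun T hT => ?_
  have h2 : T.card ≤ Sᶜ.card := card_le_card (mem_powerset.1 hT)
  have h3 : Sᶜ.card + S.card = n := by simp [card_compl_add_card]
  have h4 : n - T.card = S.card + (Sᶜ.card - T.card) := by omega
  rw [binomialWeight, h4, pow_add]
  ring

open Finset in
lemma sum_binomialWeight_separating {n : ℕ} (p : ℝ) (A B : Finset (Fin n)) :
    ∑ T : Finset (Fin n), (if Disjoint T A ∧ ¬ Disjoint T B then binomialWeight p T else 0) =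
      (1 - p) ^ A.card * (1 - (1 - p) ^ (B \ A).card) := by
  have h1 : (A ∪ B).card = A.card + (B \ A).card := by
    rw [← card_union_of_disjoint disjoint_sdiff, union_sdiff_self_eq_union]
  rw [mul_sub, mul_one, ← pow_add, ← h1, ← sum_binomialWeight_disjoint,
    ← sum_binomialWeight_disjoint, ← sum_sub_distrib]
  refine sum_congr rfl fun T _ => ?_
  by_cases hA : Disjoint T A <;> by_cases hB : Disjoint T B <;> simp [hA, hB]

lemma half_mul_le_pow_mul_one_sub_pow {p t : ℝ} {a s : ℕ} (hp0 : 0 ≤ p) (hp1 : p < 1)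
    (hpa : p * a ≤ 1 / 2) (ht0 : 0 ≤ t) (hps : t ≤ p * s) :
    1 / 2 * (t / (1 + t)) ≤ (1 - p) ^ a * (1 - (1 - p) ^ s) := by
  have h1 : 1 / 2 ≤ (1 - p) ^ a := by
    have := one_add_mul_le_pow (a := -p) (by linarith) a
    rw [← sub_eq_add_neg] at this
    linarith
  have h2 : (1 - p) ^ s ≤ 1 / (1 + t) := by
    have h3 := one_add_mul_le_pow (a := p) (by linarith) s
    rw [le_div_iff₀ (by linarith)]
    have h4 : (1 - p) ^ s * (1 + p) ^ s ≤ 1 := by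
      rw [← mul_pow]
      exact pow_le_one₀ (by nlinarith) (by nlinarith)
    have h5 : (0 : ℝ) ≤ (1 - p) ^ s := pow_nonneg (by linarith) _
    nlinarith
  have h6 : t / (1 + t) = 1 - 1 / (1 + t) := by field_simp; ring
  have h7 : 0 ≤ t / (1 + t) := by positivity
  exact mul_le_mul h1 (by linarith) h7 (by linarith)

lemma log_div_log_le {Δ : ℝ} (hΔ : 1 < Δ) :
    1 / 8 * (Real.log Δ / Real.log (max 2 Δ)) ≤
      (Δ ^ 2 - 1) / (2 * max 2 Δ) / (1 + (Δ ^ 2 - 1) / (2 * max 2 Δ)) := by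
  have hr : (Δ ^ 2 - 1) / (2 * max 2 Δ) / (1 + (Δ ^ 2 - 1) / (2 * max 2 Δ)) =
      (Δ ^ 2 - 1) / (2 * max 2 Δ + (Δ ^ 2 - 1)) := by
    have : 0 < max 2 Δ := lt_max_of_lt_left two_pos
    have : 0 < Δ ^ 2 - 1 := by nlinarith
    field_simp
  rw [hr]
  rcases le_total Δ 2 with h | h
  · rw [max_eq_left h, le_div_iff₀ (by nlinarith)]
    have h1 := Real.log_le_sub_one_of_pos (show 0 < Δ by linarith)
    have h2 := Real.log_two_gt_d9
    have h3 : Real.log Δ / Real.log 2 ≤ 2 * (Δ - 1) := by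
      rw [div_le_iff₀ (by linarith)]
      nlinarith
    calc 1 / 8 * (Real.log Δ / Real.log 2) * (2 * 2 + (Δ ^ 2 - 1))
        ≤ 1 / 8 * (2 * (Δ - 1)) * (2 * 2 + (Δ ^ 2 - 1)) := by
          have : 0 ≤ 2 * 2 + (Δ ^ 2 - 1) := by nlinarith
          gcongr
      _ ≤ Δ ^ 2 - 1 := by nlinarith [mul_nonneg (sub_nonneg.2 hΔ.le) (sub_nonneg.2 h)]
  · rw [max_eq_right h, div_self (Real.log_pos hΔ).ne', le_div_iff₀ (by nlinarith)]
    nlinarith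

open Finset in
lemma card_filter_card_le {n D : ℕ} :
    (univ.filter fun A : Finset (Fin n) => 1 ≤ A.card ∧ A.card ≤ D).card ≤ n ^ D := by
  have hsub : (univ.filter fun A : Finset (Fin n) => 1 ≤ A.card ∧ A.card ≤ D) ⊆
      univ.image fun f : Fin D → Fin n => univ.image f := by
    intro A hA
    obtain ⟨h1, h2⟩ := (mem_filter.1 hA).2
    obtain ⟨a, ha⟩ := card_pos.1 h1
    let e := A.equivFin
    refine mem_image.2 ⟨fun i => if h : i.1 < A.card then e.symm ⟨i, h⟩ else a, mem_univ _, ?_⟩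
    ext b
    simp only [mem_image, mem_univ, true_and]
    constructor
    · rintro ⟨i, rfl⟩
      split_ifs
      · exact coe_mem _
      · exact ha
    · intro hb
      refine ⟨⟨e ⟨b, hb⟩, (e ⟨b, hb⟩).2.trans_le h2⟩, ?_⟩
      simp
  calc _ ≤ _ := card_le_card hsub
    _ ≤ _ := card_image_le
    _ = n ^ D := by simp

/-- Some scale `β ^ (-(j + 1)) / 2` is a good density for separating `A` from a set `B` which is
larger by more than a factor `Δ ^ 2`. -/
lemma exists_scale_le_sum_binomialWeight {n : ℕ} {Δ : ℝ} (hΔ : 1 < Δ) {A B : Finset (Fin n)}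
    (hA : 1 ≤ A.card) (hAB : Δ ^ 2 * A.card < B.card) :
    ∃ j : ℕ, (max 2 Δ) ^ j ≤ (A.card : ℝ) ∧
      1 / 16 * (Real.log Δ / Real.log (max 2 Δ)) ≤
        ∑ T : Finset (Fin n), if Disjoint T A ∧ ¬ Disjoint T B then
          binomialWeight (1 / (2 * (max 2 Δ) ^ (j + 1))) T else 0 := by
  set β := max 2 Δ with hβ
  have hβ2 : 2 ≤ β := le_max_left _ _
  have hA' : (1 : ℝ) ≤ A.card := by exact_mod_cast hA
  obtain ⟨j, hj1, hj2⟩ := exists_nat_pow_near hA' (show 1 < β by linarith)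
  refine ⟨j, hj1, ?_⟩
  rw [sum_binomialWeight_separating]
  have hpos : 0 < β ^ (j + 1) := by positivity
  have hs : (B.card : ℝ) - A.card ≤ ((B \ A).card : ℝ) := by
    have := Finset.le_card_sdiff A B
    rw [sub_le_iff_le_add]
    exact_mod_cast (by omega : B.card ≤ (B \ A).card + A.card)
  have hΔ2 : 0 < Δ ^ 2 - 1 := by nlinarith
  refine le_trans ?_ (half_mul_le_pow_mul_one_sub_pow (t := (Δ ^ 2 - 1) / (2 * β))
    (by positivity) ?_ ?_ (by positivity) ?_)
  · have := log_div_log_le hΔ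
    rw [← hβ] at this
    linarith
  · rw [div_lt_one (by positivity)]
    linarith
  · rw [one_div_mul_eq_div, div_le_div_iff₀ (by positivity) two_pos]
    linarith
  · rw [one_div_mul_eq_div, div_le_div_iff₀ (by positivity) (by positivity), pow_succ β j]
    have h1 : (Δ ^ 2 - 1) * β ^ j ≤ ((B \ A).card : ℝ) := by
      calc (Δ ^ 2 - 1) * β ^ j ≤ (Δ ^ 2 - 1) * A.card := by gcongr
        _ ≤ _ := by linarith
    have : 0 < 2 * β := by linarith
    nlinarith

/-- A mixture of binomial random sets over logarithmically many scales separates each pair of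
sets of sizes at most `D` whose ratio exceeds `Δ ^ 2` with probability `Ω(log Δ / log D)`. -/
lemma exists_separating_tests {n D : ℕ} {Δ : ℝ} (hΔ : 1 < Δ) (hD : 2 ≤ D) (hn : 1 ≤ n)
    (hΔD : Δ < D) (m : ℕ)
    (hm : 2 * D * Real.log n < 1 / 32 * (Real.log Δ / Real.log D) * m) :
    ∃ t : Fin m → Finset (Fin n), ∀ A B : Finset (Fin n), 1 ≤ A.card → B.card ≤ D →
      Δ ^ 2 * A.card < B.card → ∃ k, Disjoint (t k) A ∧ ¬ Disjoint (t k) B := by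
  classical
  set β := max 2 Δ with hβ
  have hβ2 : 2 ≤ β := le_max_left _ _
  have hD' : (2 : ℝ) ≤ D := by exact_mod_cast hD
  have hβD : β ≤ D := max_le hD' hΔD.le
  have hlβ : 0 < Real.log β := Real.log_pos (by linarith)
  have hlD : 0 < Real.log D := Real.log_pos (by linarith)
  have hlΔ : 0 < Real.log Δ := Real.log_pos hΔ
  have hr1 : 1 ≤ Real.log D / Real.log β := by
    rw [one_le_div hlβ]
    exact Real.log_le_log (by linarith) hβD
  set J := ⌊Real.log D / Real.log β⌋₊ + 1 with hJ
  have hJle : (J : ℝ) ≤ 2 * (Real.log D / Real.log β) := by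
    have := Nat.floor_le (zero_le_one.trans hr1)
    push_cast [hJ]
    linarith
  have hJpos : (0 : ℝ) < J := by positivity
  let p : ℕ → ℝ := fun j => 1 / (2 * β ^ (j + 1))
  have hp0 : ∀ j, 0 ≤ p j := fun j => by positivity
  have hp1 : ∀ j, p j ≤ 1 := fun j => by
    have : 1 ≤ β ^ (j + 1) := one_le_pow₀ (by linarith)
    exact (div_le_one (by positivity)).2 (by linarith)
  let w : Fin J × Finset (Fin n) → ℝ := fun i => binomialWeight (p i.1) i.2 / J
  let sep : Fin J × Finset (Fin n) → Finset (Fin n) × Finset (Fin n) → Prop :=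
    fun i c => Disjoint i.2 c.1 ∧ ¬ Disjoint i.2 c.2
  let F := Finset.univ.filter fun A : Finset (Fin n) => 1 ≤ A.card ∧ A.card ≤ D
  let P := (F ×ˢ F).filter fun c => Δ ^ 2 * c.1.card < c.2.card
  have hw : ∀ i, 0 ≤ w i := fun i =>
    div_nonneg (binomialWeight_nonneg (hp0 _) (hp1 _) _) hJpos.le
  have hw1 : ∑ i, w i = 1 := by
    simp only [w, Fintype.sum_prod_type, ← Finset.sum_div, sum_binomialWeight]
    simp [hJpos.ne']
  have hq : 1 / 32 * (Real.log Δ / Real.log D) ≤ 1 := by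
    have : Real.log Δ / Real.log D ≤ 1 :=
      (div_le_one hlD).2 (Real.log_le_log (by linarith) hΔD.le)
    linarith
  have hsep : ∀ c ∈ P, 1 / 32 * (Real.log Δ / Real.log D) ≤
      ∑ i, if sep i c then w i else 0 := by
    rintro ⟨A, B⟩ hc
    simp only [P, F, Finset.mem_filter, Finset.mem_product, Finset.mem_univ, true_and] at hc
    obtain ⟨⟨⟨hA1, hAD⟩, -⟩, hAB⟩ := hc
    obtain ⟨j, hj, hsum⟩ := exists_scale_le_sum_binomialWeight hΔ hA1 hAB
    rw [← hβ] at hj hsum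
    have hjJ : j < J := by
      rw [hJ, Nat.lt_succ_iff]
      refine Nat.le_floor ?_
      rw [le_div_iff₀ hlβ, ← Real.log_pow]
      exact Real.log_le_log (by positivity) (hj.trans (by exact_mod_cast hAD))
    have hlow : 1 / 32 * (Real.log Δ / Real.log D) ≤
        1 / 16 * (Real.log Δ / Real.log β) / J := by
      rw [le_div_iff₀ hJpos]
      calc 1 / 32 * (Real.log Δ / Real.log D) * J
          ≤ 1 / 32 * (Real.log Δ / Real.log D) * (2 * (Real.log D / Real.log β)) := by gcongr
        _ = 1 / 16 * (Real.log Δ / Real.log β) := by field_simp; norm_num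
    refine hlow.trans ?_
    rw [Fintype.sum_prod_type]
    refine le_trans ?_ (Finset.single_le_sum
      (f := fun x : Fin J => ∑ T, if sep (x, T) (A, B) then w (x, T) else 0)
      (fun x _ => Finset.sum_nonneg fun T _ => ?_) (Finset.mem_univ (⟨j, hjJ⟩ : Fin J)))
    · refine (div_le_div_of_nonneg_right hsum hJpos.le).trans_eq ?_
      rw [Finset.sum_div]
      refine Finset.sum_congr rfl fun T _ => ?_
      simp only [sep, w, p]
      split_ifs <;> simp
    · split_ifs
      · exact hw _
      · exact le_rfl
  have hn' : (0 : ℝ) < n := by exact_mod_cast hn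
  have hP : (P.card : ℝ) ≤ Real.exp (2 * D * Real.log n) := by
    have h1 : P.card ≤ n ^ D * n ^ D := by
      calc P.card ≤ (F ×ˢ F).card := Finset.card_filter_le _ _
        _ = F.card * F.card := Finset.card_product _ _
        _ ≤ n ^ D * n ^ D := Nat.mul_le_mul card_filter_card_le card_filter_card_le
    have h2 : Real.exp (2 * D * Real.log n) = (n : ℝ) ^ D * (n : ℝ) ^ D := by
      rw [show 2 * D * Real.log n = D * Real.log n + D * Real.log n by ring, Real.exp_add,
        Real.exp_nat_mul, Real.exp_log hn']
    rw [h2]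
    exact_mod_cast h1
  obtain ⟨t, ht⟩ := exists_fin_forall_separated w hw hw1 sep P _ hq hsep m _ hP hm
  refine ⟨fun k => (t k).2, fun A B hA hB hAB => ht (A, B) ?_⟩
  have hAB' : (A.card : ℝ) ≤ B.card := by
    have : (A.card : ℝ) ≤ Δ ^ 2 * A.card :=
      le_mul_of_one_le_left (Nat.cast_nonneg _) (one_le_pow₀ hΔ.le)
    linarith
  have hAB'' : A.card ≤ B.card := by exact_mod_cast hAB'
  simp only [P, F, Finset.mem_filter, Finset.mem_product, Finset.mem_univ, true_and]
  exact ⟨⟨⟨hA, hAB''.trans hB⟩, hA.trans hAB'', hB⟩, hAB⟩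

/-- A decoder exists as soon as `M` distinguishes the vectors whose sparsities differ by more than
a factor `Δ ^ 2`. -/
lemma exists_decoder {m n D : ℕ} {Δ : ℝ} (hΔ : 1 < Δ) (M : Matrix (Fin m) (Fin n) (ZMod 2))
    (h : ∀ x y : Fin n → ZMod 2, 1 ≤ sparsity x → sparsity y ≤ D →
      Δ ^ 2 * sparsity x < sparsity y → orMul M x ≠ orMul M y) :
    ∃ g : (Fin m → ZMod 2) → ℝ, ∀ x : Fin n → ZMod 2, 1 ≤ sparsity x → sparsity x ≤ D →
      (sparsity x : ℝ) / Δ ≤ g (orMul M x) ∧ g (orMul M x) ≤ Δ * (sparsity x : ℝ) := by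
  classical
  let S : (Fin m → ZMod 2) → Finset (Fin n → ZMod 2) := fun y =>
    Finset.univ.filter fun x => sparsity x ≤ D ∧ orMul M x = y
  refine ⟨fun y => ((S y).sup sparsity : ℕ) / Δ, fun x hx1 hxD => ?_⟩
  have hmem : x ∈ S (orMul M x) := by simp [S, hxD]
  have hΔ0 : 0 < Δ := by linarith
  constructor
  · have : sparsity x ≤ (S (orMul M x)).sup sparsity := Finset.le_sup hmem
    exact div_le_div_of_nonneg_right (by exact_mod_cast this) hΔ0.le
  · obtain ⟨y, hy, hye⟩ := Finset.exists_mem_eq_sup _ ⟨x, hmem⟩ sparsity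
    simp only [hye]
    rw [div_le_iff₀ hΔ0]
    by_contra! hcon
    simp only [S, Finset.mem_filter, Finset.mem_univ, true_and] at hy
    exact h x y hx1 hy.1 (by linarith [hcon]) hy.2.symm

/-- Upper bound for noiseless group testing sparsity approximation: there is a universal
constant `C > 0` such that for every `Δ > 1` and `2 ≤ D ≤ n` there is a test matrix with
`m ≤ C·(1 + D·log₂(D)·log₂(n)/log₂(Δ))` rows together with a decoder that
`Δ`-approximates the sparsity of every vector of sparsity between `1` and `D`. -/
theorem pool_ub :
    ∃ C : ℝ, 0 < C ∧ ∀ Δ : ℝ, 1 < Δ → ∀ D n : ℕ, 2 ≤ D → D ≤ n →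
      ∃ m : ℕ,
        (m : ℝ) ≤ C * (1 + (D : ℝ) * Real.logb 2 (D : ℝ) * Real.logb 2 (n : ℝ) /
          Real.logb 2 Δ) ∧
        ∃ (M : Matrix (Fin m) (Fin n) (ZMod 2)) (g : (Fin m → ZMod 2) → ℝ),
          ∀ x : Fin n → ZMod 2, 1 ≤ sparsity x → sparsity x ≤ D →
            (sparsity x : ℝ) / Δ ≤ g (orMul M x) ∧ g (orMul M x) ≤ Δ * (sparsity x : ℝ) := by
  refine ⟨64, by norm_num, fun Δ hΔ D n hD hDn => ?_⟩
  have hD' : (2 : ℝ) ≤ D := by exact_mod_cast hD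
  have hn' : (2 : ℝ) ≤ n := by exact_mod_cast hD.trans hDn
  have hl2 : 0 < Real.log 2 := Real.log_pos one_lt_two
  have hlD : 0 < Real.log D := Real.log_pos (by linarith)
  have hln : 0 < Real.log n := Real.log_pos (by linarith)
  have hlΔ : 0 < Real.log Δ := Real.log_pos hΔ
  rcases lt_or_ge Δ D with hΔD | hΔD
  · set L := 64 * (D * Real.log D * Real.log n / Real.log Δ) with hL
    have hL0 : 0 ≤ L := by positivity
    refine ⟨⌊L⌋₊ + 1, ?_, ?_⟩
    · have hle : D * Real.log D * Real.log n / Real.log Δ ≤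
          (D : ℝ) * Real.logb 2 (D : ℝ) * Real.logb 2 (n : ℝ) / Real.logb 2 Δ := by
        have he : (D : ℝ) * Real.logb 2 (D : ℝ) * Real.logb 2 (n : ℝ) / Real.logb 2 Δ =
            D * Real.log D * Real.log n / Real.log Δ / Real.log 2 := by
          simp only [Real.logb]
          field_simp
        rw [he, le_div_iff₀ hl2]
        have : Real.log 2 ≤ 1 := by linarith [Real.log_two_lt_d9]
        exact mul_le_of_le_one_right (by positivity) this
      have := Nat.floor_le hL0
      push_cast
      linarith
    · obtain ⟨t, ht⟩ := exists_separating_tests hΔ hD (by omega : 1 ≤ n) hΔD (⌊L⌋₊ + 1) (by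
        have h1 : L < ((⌊L⌋₊ + 1 : ℕ) : ℝ) := by exact_mod_cast Nat.lt_floor_add_one L
        calc 2 * D * Real.log n = 1 / 32 * (Real.log Δ / Real.log D) * L := by
              rw [hL]; field_simp; norm_num
          _ < _ := by gcongr)
      let M : Matrix (Fin (⌊L⌋₊ + 1)) (Fin n) (ZMod 2) :=
        fun k i => if i ∈ t k then 1 else 0
      refine ⟨M, exists_decoder hΔ M fun x y hx hy hxy heq => ?_⟩
      obtain ⟨k, hkx, hky⟩ := ht _ _ hx hy hxy
      have hor : ∀ z : Fin n → ZMod 2, orMul M z k = 1 ↔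
          ¬ Disjoint (t k) (Finset.univ.filter fun i => z i ≠ 0) := by
        intro z
        have hz : ∀ a : ZMod 2, a = 1 ↔ a ≠ 0 := by decide
        simp [orMul, M, Finset.not_disjoint_iff, hz]
      exact (hor x).1 (heq ▸ (hor y).2 hky) hkx
  · refine ⟨0, ?_, ?_⟩
    · have h1 : 0 < Real.logb 2 D := div_pos hlD hl2
      have h2 : 0 < Real.logb 2 n := div_pos hln hl2
      have h3 : 0 < Real.logb 2 Δ := div_pos hlΔ hl2
      push_cast
      positivity
    · refine ⟨0, exists_decoder hΔ 0 fun x y hx hy hxy => ?_⟩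
      have hx' : (1 : ℝ) ≤ sparsity x := by exact_mod_cast hx
      have hy' : (sparsity y : ℝ) ≤ D := by exact_mod_cast hy
      nlinarith
end

section
/- Let Δ > 1 be real, let n, D, m, e₀, e₁ be naturals with Δ² < D ≤ n/2, set E = e₀ + e₁, and assume 1 ≤ E < m. Suppose M ∈ F₂^{m×n} satisfies: for all subsets S₁, S₂ ⊆ [n] with 1 ≤ |S₂| ≤ |S₁| ≤ D and |S₁| > Δ²·|S₂|, the pair (M⊙v(S₁), M⊙v(S₂)) is (E, E)-far. Then m ≥ (D/Δ² − 1)·log₂(n/(D − Δ²)) − (D/Δ² − 1)·log₂ e + E − (E/2)·log₂ E + (E/2)·log₂(m − E). -/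
/-- The indicator vector `v(S) ∈ F₂ⁿ` of a subset `S ⊆ [n]`. -/
def indic {n : ℕ} (S : Finset (Fin n)) : Fin n → ZMod 2 :=
  fun j => if j ∈ S then 1 else 0

/-- The support of a vector over `F₂`: the set of coordinates equal to `1`. -/
def supp {m : ℕ} (u : Fin m → ZMod 2) : Finset (Fin m) :=
  Finset.univ.filter (fun i => u i = 1)

/-- `(u, w)` is `(e₀,e₁)`-close iff `|supp(w) ∖ supp(u)| ≤ e₀` and
`|supp(u) ∖ supp(w)| ≤ e₁`. -/
def close {m : ℕ} (e₀ e₁ : ℕ) (u w : Fin m → ZMod 2) : Prop :=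
  (supp w \ supp u).card ≤ e₀ ∧ (supp u \ supp w).card ≤ e₁

open scoped Classical in
/-- The rows of `M` that test no column of `S`, i.e. the negative tests of the pool `S`. -/
noncomputable def negRows {m n : ℕ} (M : Matrix (Fin m) (Fin n) (ZMod 2)) (S : Finset (Fin n)) :
    Finset (Fin m) :=
  Finset.univ.filter fun i => ∀ j ∈ S, M i j ≠ 1

theorem mem_supp_orMul_indic {m n : ℕ} (M : Matrix (Fin m) (Fin n) (ZMod 2))
    (S : Finset (Fin n)) (i : Fin m) :
    i ∈ supp (orMul M (indic S)) ↔ ∃ j ∈ S, M i j = 1 := by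
  have h : ∀ j, indic S j = 1 ↔ j ∈ S := by
    intro j
    unfold indic
    split_ifs with hj <;> simp [hj]
  simp only [supp, orMul, Finset.mem_filter, Finset.mem_univ, true_and, h]
  split_ifs with hx
  · simpa [and_comm] using hx
  · simpa [and_comm] using hx

theorem close_of_negRows {m n : ℕ} {M : Matrix (Fin m) (Fin n) (ZMod 2)}
    {S T : Finset (Fin n)} {V : Finset (Fin m)} {E : ℕ} (hST : S ⊆ T)
    (hT : V ⊆ negRows M T) (hV : (negRows M S).card ≤ V.card + E) :
    close E E (orMul M (indic T)) (orMul M (indic S)) := by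
  have hTS : negRows M T ⊆ negRows M S := by
    intro i hi
    simp only [negRows, Finset.mem_filter, Finset.mem_univ, true_and] at hi ⊢
    exact fun j hj => hi j (hST hj)
  constructor
  · have : supp (orMul M (indic S)) \ supp (orMul M (indic T)) = ∅ := by
      rw [Finset.sdiff_eq_empty_iff_subset]
      intro i hi
      rw [mem_supp_orMul_indic] at hi ⊢
      obtain ⟨j, hj, hij⟩ := hi
      exact ⟨j, hST hj, hij⟩
    simp [this]
  · have hsub : supp (orMul M (indic T)) \ supp (orMul M (indic S)) ⊆ negRows M S \ V := by
      intro i hi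
      rw [Finset.mem_sdiff, mem_supp_orMul_indic, mem_supp_orMul_indic] at hi
      obtain ⟨⟨j, hj, hij⟩, h2⟩ := hi
      rw [Finset.mem_sdiff]
      refine ⟨?_, fun hiV => ?_⟩
      · simp only [negRows, Finset.mem_filter, Finset.mem_univ, true_and]
        exact fun j hj h => h2 ⟨j, hj, h⟩
      · have := hT hiV
        simp only [negRows, Finset.mem_filter, Finset.mem_univ, true_and] at this
        exact this j hj hij
    have h1 := Finset.card_le_card hsub
    rw [Finset.card_sdiff_of_subset (hT.trans hTS)] at h1
    omega

/-- The columns of `M` that vanish on the rows in `V`. -/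
def avoidingCols {m n : ℕ} (M : Matrix (Fin m) (Fin n) (ZMod 2)) (V : Finset (Fin m)) :
    Finset (Fin n) :=
  Finset.univ.filter fun j => ∀ i ∈ V, M i j ≠ 1

theorem subset_negRows_iff {m n : ℕ} (M : Matrix (Fin m) (Fin n) (ZMod 2))
    (S : Finset (Fin n)) (V : Finset (Fin m)) :
    V ⊆ negRows M S ↔ S ⊆ avoidingCols M V := by
  simp only [negRows, avoidingCols, Finset.subset_iff, Finset.mem_filter, Finset.mem_univ,
    true_and]
  exact ⟨fun h j hj i hi => h hi j hj, fun h i hi j hj => h hj i hi⟩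

section Counting

variable {m n d U E : ℕ} {M : Matrix (Fin m) (Fin n) (ZMod 2)}

theorem card_avoidingCols_le (hdU : d ≤ U)
    (hfar : ∀ S T : Finset (Fin n), S.card = d → T.card = U + 1 → S ⊆ T →
      ¬ close E E (orMul M (indic T)) (orMul M (indic S)))
    {S : Finset (Fin n)} {V : Finset (Fin m)} (hS : S.card = d) (hV : V ⊆ negRows M S)
    (hVE : (negRows M S).card ≤ V.card + E) : (avoidingCols M V).card ≤ U := by
  by_contra! hlt
  have hSV := (subset_negRows_iff M S V).1 hV
  obtain ⟨T, hST, hTV, hT⟩ :=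
    Finset.exists_subsuperset_card_eq hSV (by omega : S.card ≤ U + 1) hlt
  exact hfar S T hS hT hST (close_of_negRows hST ((subset_negRows_iff M T V).2 hTV) hVE)

theorem lt_card_negRows (hdU : d ≤ U) (hUn : U < n)
    (hfar : ∀ S T : Finset (Fin n), S.card = d → T.card = U + 1 → S ⊆ T →
      ¬ close E E (orMul M (indic T)) (orMul M (indic S)))
    {S : Finset (Fin n)} (hS : S.card = d) : E < (negRows M S).card := by
  by_contra! hle
  have h := card_avoidingCols_le hdU hfar (V := ∅) hS (by simp) (by simpa using hle)
  simp [avoidingCols] at h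
  omega

/-- Counting bound for pools of size `d` with exactly `z` negative tests. -/
theorem card_level_mul_choose_le (hdU : d ≤ U) (hUn : U < n)
    (hfar : ∀ S T : Finset (Fin n), S.card = d → T.card = U + 1 → S ⊆ T →
      ¬ close E E (orMul M (indic T)) (orMul M (indic S))) (z : ℕ) :
    ((Finset.powersetCard d Finset.univ).filter fun S => (negRows M S).card = z).card *
        (m + E).choose E ≤ (m + E).choose z * U.choose d := by
  classical
  set A := (Finset.powersetCard d (Finset.univ : Finset (Fin n))).filter
    fun S => (negRows M S).card = z with hA
  rcases A.eq_empty_or_nonempty with h0 | ⟨S₀, hS₀⟩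
  · simp [h0]
  have hmem : ∀ S ∈ A, S.card = d ∧ (negRows M S).card = z := by
    intro S hS
    simpa [hA, Finset.mem_powersetCard] using hS
  have hzE : E < z := by
    have := lt_card_negRows hdU hUn hfar (hmem S₀ hS₀).1
    rwa [(hmem S₀ hS₀).2] at this
  have hzm : z ≤ m := by
    rw [← (hmem S₀ hS₀).2]
    simpa using Finset.card_le_univ (negRows M S₀)
  have key : A.card * z.choose E ≤ m.choose (z - E) * U.choose d := by
    have := Finset.card_mul_le_card_mul (s := A)
      (t := Finset.powersetCard (z - E) (Finset.univ : Finset (Fin m)))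
      (m := z.choose E) (n := U.choose d) (fun S V => V ⊆ negRows M S) ?_ ?_
    · simpa [Finset.card_powersetCard] using this
    · intro S hS
      have hsub : Finset.powersetCard (z - E) (negRows M S) ⊆
          Finset.bipartiteAbove (fun S V => V ⊆ negRows M S)
            (Finset.powersetCard (z - E) (Finset.univ : Finset (Fin m))) S := by
        intro V hV
        rw [Finset.mem_powersetCard] at hV
        simp [Finset.mem_bipartiteAbove, Finset.mem_powersetCard, hV.1, hV.2]
      have := Finset.card_le_card hsub
      rwa [Finset.card_powersetCard, (hmem S hS).2, Nat.choose_symm hzE.le] at this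
    · intro V hV
      have hVc : V.card = z - E := (Finset.mem_powersetCard.1 hV).2
      set B := Finset.bipartiteBelow (fun S V => V ⊆ negRows M S) A V with hB
      rcases B.eq_empty_or_nonempty with hB0 | ⟨S₁, hS₁⟩
      · simp [hB0]
      have hBm : ∀ S ∈ B, S ∈ A ∧ V ⊆ negRows M S := by
        intro S hS
        simpa [hB, Finset.mem_bipartiteBelow] using hS
      have hcov : (avoidingCols M V).card ≤ U := by
        refine card_avoidingCols_le hdU hfar (hmem S₁ (hBm S₁ hS₁).1).1 (hBm S₁ hS₁).2 ?_
        rw [(hmem S₁ (hBm S₁ hS₁).1).2]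
        omega
      have hsub : B ⊆ Finset.powersetCard d (avoidingCols M V) := by
        intro S hS
        rw [Finset.mem_powersetCard]
        exact ⟨(subset_negRows_iff M S V).1 (hBm S hS).2, (hmem S (hBm S hS).1).1⟩
      calc B.card ≤ (avoidingCols M V).card.choose d := by
            simpa [Finset.card_powersetCard] using Finset.card_le_card hsub
        _ ≤ U.choose d := Nat.choose_le_choose d hcov
  have hid : (m + E).choose z * z.choose E = (m + E).choose E * m.choose (z - E) := by
    have := Nat.choose_mul (n := m + E) (k := z) (s := E) hzE.le
    simpa using this
  refine Nat.le_of_mul_le_mul_right ?_ (Nat.choose_pos hzE.le)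
  calc A.card * (m + E).choose E * z.choose E
      = (A.card * z.choose E) * (m + E).choose E := by ring
    _ ≤ (m.choose (z - E) * U.choose d) * (m + E).choose E := Nat.mul_le_mul_right _ key
    _ = ((m + E).choose E * m.choose (z - E)) * U.choose d := by ring
    _ = (m + E).choose z * U.choose d * z.choose E := by rw [← hid]; ring

theorem choose_mul_choose_le_two_pow (hdU : d ≤ U) (hUn : U < n)
    (hfar : ∀ S T : Finset (Fin n), S.card = d → T.card = U + 1 → S ⊆ T →
      ¬ close E E (orMul M (indic T)) (orMul M (indic S))) :
    n.choose d * (m + E).choose E ≤ 2 ^ (m + E) * U.choose d := by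
  have hcard : n.choose d = ∑ z ∈ Finset.range (m + E + 1),
      ((Finset.powersetCard d Finset.univ).filter fun S => (negRows M S).card = z).card := by
    rw [← Finset.card_eq_sum_card_fiberwise]
    · simp
    · intro S _
      have : (negRows M S).card ≤ m := by simpa using Finset.card_le_univ (negRows M S)
      simp
      omega
  rw [hcard, Finset.sum_mul, ← Nat.sum_range_choose, Finset.sum_mul]
  exact Finset.sum_le_sum fun z _ => card_level_mul_choose_le hdU hUn hfar z

end Counting

theorem descFactorial_mul_pow_le {U n : ℕ} (hUn : U ≤ n) (d : ℕ) :
    U.descFactorial d * n ^ d ≤ n.descFactorial d * U ^ d := by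
  induction d with
  | zero => simp
  | succ d ih =>
    have h : (U - d) * n ≤ (n - d) * U := by
      rw [Nat.sub_mul, Nat.sub_mul, mul_comm n U]
      exact Nat.sub_le_sub_left (Nat.mul_le_mul_left d hUn) _
    rw [Nat.descFactorial_succ, Nat.descFactorial_succ, pow_succ, pow_succ]
    calc (U - d) * U.descFactorial d * (n ^ d * n)
        = ((U - d) * n) * (U.descFactorial d * n ^ d) := by ring
      _ ≤ ((n - d) * U) * (n.descFactorial d * U ^ d) := Nat.mul_le_mul h ih
      _ = _ := by ring

theorem choose_mul_pow_le {U n : ℕ} (hUn : U ≤ n) (d : ℕ) :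
    U.choose d * n ^ d ≤ n.choose d * U ^ d := by
  have h := descFactorial_mul_pow_le hUn d
  rw [Nat.descFactorial_eq_factorial_mul_choose, Nat.descFactorial_eq_factorial_mul_choose,
    mul_assoc, mul_assoc] at h
  exact Nat.le_of_mul_le_mul_left h d.factorial_pos

theorem sixteen_mul_pow_le_choose_sq (k E : ℕ) (hE : 1 ≤ E) :
    (16 * (k : ℝ)) ^ E ≤ 2 * ((k + 2 * E).choose E : ℝ) ^ 2 * (E : ℝ) ^ E := by
  have hk : (0 : ℝ) ≤ k := Nat.cast_nonneg k
  have hasc : ((k + 2 * E).choose E : ℝ) * (E.factorial : ℝ) =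
      ∏ i ∈ Finset.range E, ((k : ℝ) + E + 1 + i) := by
    have h := Nat.ascFactorial_eq_factorial_mul_choose (k + E) E
    rw [Nat.ascFactorial_eq_prod_range, show k + E + E = k + 2 * E by ring] at h
    rw [mul_comm]
    exact_mod_cast h.symm
  have hfac : (E.factorial : ℝ) = ∏ i ∈ Finset.range E, ((i : ℝ) + 1) := by
    rw [← Finset.prod_range_add_one_eq_factorial]
    push_cast
    rfl
  have hfpos : (0 : ℝ) < (E.factorial : ℝ) := by exact_mod_cast E.factorial_pos
  rcases Nat.lt_or_ge E 4 with hlt | hge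
  · interval_cases E
    · simp at hasc
      norm_num at hasc ⊢
      nlinarith [sq_nonneg ((k : ℝ) - 2)]
    · norm_num [Finset.prod_range_succ, Nat.factorial] at hasc ⊢
      have h1 : 6 * (k : ℝ) ≤ ((k + 4).choose 2 : ℝ) := by
        nlinarith [sq_nonneg ((k : ℝ) - 3)]
      nlinarith [mul_self_le_mul_self (by positivity) h1]
    · norm_num [Finset.prod_range_succ, Nat.factorial] at hasc ⊢
      set C := ((k + 6).choose 3 : ℝ)
      have h1 : 20 * (k : ℝ) ≤ (k + 5) ^ 2 := by nlinarith [sq_nonneg ((k : ℝ) - 5)]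
      have h2 : 19 * (k : ℝ) ≤ (k + 4) * (k + 6) := by nlinarith [sq_nonneg ((k : ℝ) - 5)]
      have h3 : (19 * (k : ℝ)) ^ 2 ≤ ((k + 4) * (k + 6)) ^ 2 := by gcongr
      have h4 : 20 * (k : ℝ) * (19 * (k : ℝ)) ^ 2 ≤ (k + 5) ^ 2 * ((k + 4) * (k + 6)) ^ 2 := by
        gcongr
      have h5 : (C * 6) ^ 2 = ((k : ℝ) + 5) ^ 2 * ((k + 4) * (k + 6)) ^ 2 := by
        rw [hasc]; ring
      have h6 : (0 : ℝ) ≤ k ^ 3 := by positivity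
      nlinarith
  · have hE4 : (4 : ℝ) ≤ E := by exact_mod_cast hge
    have hreflect : ∀ f : ℕ → ℝ, (∏ i ∈ Finset.range E, f i) ^ 2 =
        ∏ i ∈ Finset.range E, f i * f (E - 1 - i) := by
      intro f
      rw [Finset.prod_mul_distrib, Finset.prod_range_reflect, sq]
    have hmain : (16 * (k : ℝ)) ^ E * (E.factorial : ℝ) ^ 2 ≤
        (((k + 2 * E).choose E : ℝ) * (E.factorial : ℝ)) ^ 2 * (E : ℝ) ^ E := by
      rw [hasc, hfac, hreflect, hreflect]
      have hpow : ∀ x : ℝ, x ^ E = ∏ _i ∈ Finset.range E, x := by intro x; simp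
      rw [hpow, hpow, ← Finset.prod_mul_distrib, ← Finset.prod_mul_distrib]
      apply Finset.prod_le_prod
      · intro i _; positivity
      · intro i hi
        have hi' : i + 1 ≤ E := Finset.mem_range.1 hi
        have hcast : ((E - 1 - i : ℕ) : ℝ) = (E : ℝ) - 1 - i := by
          rw [Nat.cast_sub (by omega), Nat.cast_sub (by omega)]; simp
        rw [hcast]
        have hiR : (i : ℝ) + 1 ≤ E := by exact_mod_cast hi'
        have hi0 : (0 : ℝ) ≤ i := Nat.cast_nonneg i
        obtain ⟨p, hp⟩ : ∃ p : ℝ, p = ((i : ℝ) + 1) * (E - i) := ⟨_, rfl⟩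
        have hp0 : 0 ≤ p := by rw [hp]; apply mul_nonneg <;> linarith
        have hp4 : 4 * p ≤ ((E : ℝ) + 1) ^ 2 := by
          rw [hp]; nlinarith [sq_nonneg (2 * (i : ℝ) + 1 - E)]
        have e1 : 16 * (k : ℝ) * (((i : ℝ) + 1) * ((E : ℝ) - 1 - i + 1)) = 16 * k * p := by
          rw [hp]; ring
        have e2 : ((k : ℝ) + E + 1 + i) * ((k : ℝ) + E + 1 + ((E : ℝ) - 1 - i)) * E =
            E * ((k + E) * (k + 2 * E + 1) + p) := by
          rw [hp]; ring
        rw [e1, e2]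
        have h1 : 0 ≤ (k : ℝ) * ((E : ℝ) ^ 2 - 3 * E - 2) :=
          mul_nonneg hk (by nlinarith)
        have h2 : 4 * (k : ℝ) * (E + 1) ^ 2 ≤ E * ((k : ℝ) + (3 * E + 1) / 2) ^ 2 := by
          nlinarith [mul_nonneg (by linarith : (0 : ℝ) ≤ E)
            (sq_nonneg ((k : ℝ) - (3 * E + 1) / 2))]
        have h3 : 0 ≤ ((E : ℝ) + 1) ^ 2 - 4 * p := by linarith
        rcases le_total (E : ℝ) (16 * k) with hc | hc
        · nlinarith [mul_nonneg (by linarith : (0 : ℝ) ≤ 16 * k - E) h3]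
        · have : 0 ≤ (E : ℝ) * ((k + E) * (k + 2 * E + 1)) := by positivity
          nlinarith [mul_le_mul_of_nonneg_right hc hp0]
    have h2 : (0 : ℝ) < (E.factorial : ℝ) ^ 2 := by positivity
    have h3 : (16 * (k : ℝ)) ^ E ≤ ((k + 2 * E).choose E : ℝ) ^ 2 * (E : ℝ) ^ E := by
      refine le_of_mul_le_mul_right (hmain.trans_eq ?_) h2
      ring
    have h4 : (0 : ℝ) ≤ ((k + 2 * E).choose E : ℝ) ^ 2 * (E : ℝ) ^ E := by positivity
    linarith

/-- Rounding: passing from real `s` to `d ≥ s`, `d ≥ 1`, costs at most `s - log 2 / 2`. -/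
theorem mul_log_div_sub_le {c s d : ℝ} (hs : 0 < s) (hsd : s ≤ d) (hd : 1 ≤ d)
    (hc : 2 * d ≤ c) :
    s * Real.log (c / s) - s + Real.log 2 / 2 ≤ d * Real.log (c / d) := by
  have hd0 : 0 < d := by linarith
  have hcd : Real.log 2 ≤ Real.log (c / d) :=
    Real.log_le_log (by norm_num) (by rw [le_div_iff₀ hd0]; exact hc)
  have hsplit : Real.log (c / s) = Real.log (c / d) + Real.log (d / s) := by
    rw [← Real.log_mul (by apply ne_of_gt; apply div_pos <;> linarith)
      (by positivity)]
    congr 1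
    field_simp
  have hds : s * Real.log (d / s) ≤ 2 * d / Real.exp 2 + s * (1 - Real.log 2) := by
    have h1 := Real.log_le_sub_one_of_pos (x := d / s * (2 / Real.exp 2)) (by positivity)
    rw [Real.log_mul (by positivity) (by positivity),
      Real.log_div (by norm_num) (Real.exp_ne_zero 2), Real.log_exp] at h1
    have h2 : s * (d / s * (2 / Real.exp 2)) = 2 * d / Real.exp 2 := by field_simp
    nlinarith
  have hexp : (6 : ℝ) ≤ Real.exp 2 := by
    have h1 : Real.exp 2 = Real.exp 1 * Real.exp 1 := by rw [← Real.exp_add]; norm_num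
    have := Real.exp_one_gt_d9
    rw [h1]; nlinarith
  have h3 : 2 * d / Real.exp 2 ≤ d / 3 := by
    rw [div_le_div_iff₀ (Real.exp_pos 2) (by norm_num)]
    nlinarith
  have hl := Real.log_two_gt_d9
  rw [hsplit]
  nlinarith [mul_le_mul_of_nonneg_left hcd (sub_nonneg.2 hsd)]

/-- Lower bound on the number of tests for noisy group testing sparsity approximation:
with `E = e₀ + e₁`, `1 ≤ E < m`, and `Δ² < D ≤ n/2`, any matrix whose outputs on
defective sets differing in size by more than a `Δ²` factor are `(E,E)`-far satisfies
`m ≥ (D/Δ² − 1)·log₂(n/(D − Δ²)) − (D/Δ² − 1)·log₂ e + E − (E/2)·log₂ E + (E/2)·log₂(m − E)`. -/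
theorem noisy_pool_lb {m n D e₀ e₁ : ℕ} (Δ : ℝ) (hΔ : 1 < Δ)
    (hΔD : Δ ^ 2 < (D : ℝ)) (hDn : (D : ℝ) ≤ (n : ℝ) / 2)
    (hE1 : 1 ≤ e₀ + e₁) (hEm : e₀ + e₁ < m)
    (M : Matrix (Fin m) (Fin n) (ZMod 2))
    (hfar : ∀ S₁ S₂ : Finset (Fin n), 1 ≤ S₂.card → S₂.card ≤ S₁.card → S₁.card ≤ D →
      (S₁.card : ℝ) > Δ ^ 2 * (S₂.card : ℝ) →
      ¬ close (e₀ + e₁) (e₀ + e₁) (orMul M (indic S₁)) (orMul M (indic S₂))) :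
    ((D : ℝ) / Δ ^ 2 - 1) * Real.logb 2 ((n : ℝ) / ((D : ℝ) - Δ ^ 2)) -
      ((D : ℝ) / Δ ^ 2 - 1) * Real.logb 2 (Real.exp 1) +
      ((e₀ + e₁ : ℕ) : ℝ) -
      (((e₀ + e₁ : ℕ) : ℝ) / 2) * Real.logb 2 ((e₀ + e₁ : ℕ) : ℝ) +
      (((e₀ + e₁ : ℕ) : ℝ) / 2) * Real.logb 2 ((m : ℝ) - ((e₀ + e₁ : ℕ) : ℝ)) ≤ (m : ℝ) := by
  set E := e₀ + e₁ with hE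
  have hΔ2 : 1 < Δ ^ 2 := by nlinarith
  have hΔpos : 0 < Δ ^ 2 := by linarith
  have hK : 1 < (D : ℝ) / Δ ^ 2 := by rwa [one_lt_div hΔpos]
  obtain ⟨d, hd1, hdK, hKd⟩ : ∃ d : ℕ, 1 ≤ d ∧ (d : ℝ) < D / Δ ^ 2 ∧
      (D : ℝ) / Δ ^ 2 - 1 ≤ d := by
    have hlt : 1 < ⌈(D : ℝ) / Δ ^ 2⌉₊ := Nat.lt_ceil.2 (by simpa using hK)
    refine ⟨⌈(D : ℝ) / Δ ^ 2⌉₊ - 1, by omega, Nat.lt_ceil.1 (by omega), ?_⟩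
    rw [Nat.cast_sub hlt.le]
    simpa using Nat.le_ceil ((D : ℝ) / Δ ^ 2)
  have hd1R : (1 : ℝ) ≤ d := by exact_mod_cast hd1
  have hdD : Δ ^ 2 * d < D := by
    rw [lt_div_iff₀ hΔpos] at hdK
    linarith
  obtain ⟨U, hU⟩ : ∃ U : ℕ, U = ⌊Δ ^ 2 * (d : ℝ)⌋₊ := ⟨_, rfl⟩
  have hUle : (U : ℝ) ≤ Δ ^ 2 * d := hU ▸ Nat.floor_le (by positivity)
  have hdU : d ≤ U := hU ▸ Nat.le_floor (by nlinarith)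
  have hUD : U < D := by exact_mod_cast hUle.trans_lt hdD
  have hltU : Δ ^ 2 * (d : ℝ) < ((U + 1 : ℕ) : ℝ) := by
    rw [hU]; exact_mod_cast Nat.lt_floor_add_one _
  have hnpos : (0 : ℝ) < n := by linarith
  have hDn' : D ≤ n := by
    have : (D : ℝ) ≤ n := by linarith
    exact_mod_cast this
  have hcount := choose_mul_choose_le_two_pow (M := M) (E := E) hdU (by omega : U < n) (by
    intro S T hS hT _
    refine hfar T S (by omega) (by omega) (by omega) ?_
    rw [hS, hT]
    exact hltU)
  have hnat : n ^ d * (m + E).choose E ≤ U ^ d * 2 ^ (m + E) := by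
    refine Nat.le_of_mul_le_mul_right ?_ (Nat.choose_pos hdU)
    calc n ^ d * (m + E).choose E * U.choose d
        = U.choose d * n ^ d * (m + E).choose E := by ring
      _ ≤ n.choose d * U ^ d * (m + E).choose E :=
        Nat.mul_le_mul_right _ (choose_mul_pow_le (by omega) d)
      _ = n.choose d * (m + E).choose E * U ^ d := by ring
      _ ≤ 2 ^ (m + E) * U.choose d * U ^ d := Nat.mul_le_mul_right _ hcount
      _ = U ^ d * 2 ^ (m + E) * U.choose d := by ring
  have hCpos : (0 : ℝ) < ((m + E).choose E : ℝ) := by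
    exact_mod_cast Nat.choose_pos (Nat.le_add_left E m)
  have hdpos : (0 : ℝ) < d := by linarith
  have hlog : d * Real.log ((n : ℝ) / Δ ^ 2 / d) + Real.log ((m + E).choose E : ℝ) ≤
      (m + E) * Real.log 2 := by
    have h1 : (n : ℝ) ^ d * ((m + E).choose E : ℝ) ≤ (Δ ^ 2 * d) ^ d * 2 ^ (m + E) := by
      calc (n : ℝ) ^ d * ((m + E).choose E : ℝ) ≤ (U : ℝ) ^ d * 2 ^ (m + E) := by
            exact_mod_cast hnat
        _ ≤ _ := by gcongr
    have h2 := Real.log_le_log (by positivity) h1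
    rw [Real.log_mul (by positivity) (by positivity), Real.log_mul (by positivity)
      (by positivity), Real.log_pow, Real.log_pow, Real.log_pow] at h2
    rw [div_div, Real.log_div (by positivity) (by positivity)]
    push_cast at h2
    linarith
  have hER : (1 : ℝ) ≤ E := by exact_mod_cast hE1
  have hmE : (0 : ℝ) < (m : ℝ) - E := by
    rw [sub_pos]; exact_mod_cast hEm
  have hClog : 4 * E * Real.log 2 + E * Real.log ((m : ℝ) - E) ≤
      Real.log 2 + 2 * Real.log ((m + E).choose E : ℝ) + E * Real.log E := by
    have h1 := sixteen_mul_pow_le_choose_sq (m - E) E hE1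
    rw [Nat.cast_sub hEm.le, show m - E + 2 * E = m + E by omega] at h1
    have h2 := Real.log_le_log (by positivity) h1
    rw [Real.log_pow, Real.log_mul (by norm_num) hmE.ne', Real.log_mul (by positivity)
      (by positivity), Real.log_mul (by norm_num) (by positivity), Real.log_pow, Real.log_pow,
      show (16 : ℝ) = 2 ^ 4 by norm_num, Real.log_pow] at h2
    push_cast at h2
    linarith
  have hround := mul_log_div_sub_le (c := (n : ℝ) / Δ ^ 2) (sub_pos.2 hK) hKd hd1R (by
    rw [le_div_iff₀ hΔpos]
    linarith)
  have harg : (n : ℝ) / Δ ^ 2 / (D / Δ ^ 2 - 1) = n / (D - Δ ^ 2) := by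
    rw [div_div]
    congr 1
    field_simp
  rw [harg] at hround
  generalize (D : ℝ) / Δ ^ 2 - 1 = s at hround ⊢
  have hl2 : 0 < Real.log 2 := Real.log_pos (by norm_num)
  simp only [Real.logb, Real.log_exp]
  refine le_of_mul_le_mul_right ?_ hl2
  field_simp
  linarith
end
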